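/- Let K ≥ 1 be an integer and for each i ∈ {1,…,K} let w_i > 0, η_i > 0, ŕ_i ∈ (−1, 1], and ℓ_i ∈ [0,1] be reals with η_i ≤ 2/(3·(1 + ŕ_i)). Define Z = Σ_{j=1}^{K} η_j·w_j·exp(η_j·ŕ_j), p_i = η_i·w_i·exp(η_i·ŕ_i)/Z, and r_i = Σ_{j=1}^{K} p_j·ℓ_j − ℓ_i. Then Σ_{i=1}^{K} w_i·exp( η_i·r_i − η_i²·(r_i − ŕ_i)² ) ≤ Σ_{i=1}^{K} w_i. -/

import Mathlib

/-- The derivative of `log (1 + x) - x + x ^ 2`, in factored form. -/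
lemma hasDerivAt_log_one_add_sub_add_sq {x : ℝ} (hx : -1 < x) :
    HasDerivAt (fun y : ℝ => Real.log (1 + y) - y + y ^ 2) (x * (1 + 2 * x) / (1 + x)) x := by
  have hx' : 1 + x ≠ 0 := by linarith
  convert! ((((hasDerivAt_id x).const_add 1).log hx').sub (hasDerivAt_id x)).add
    ((hasDerivAt_id x).pow 2) using 1
  simp only [id]
  field_simp
  ring

/-- The Prod inequality. -/
lemma sub_sq_le_log_one_add {x : ℝ} (hx : -(2 / 3) ≤ x) : x - x ^ 2 ≤ Real.log (1 + x) := by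
  rcases le_total 0 x with h0 | h0
  · refine le_trans ?_ (Real.le_log_one_add_of_nonneg h0)
    rw [le_div_iff₀ (by linarith)]
    nlinarith [mul_nonneg h0 (sq_nonneg x), sq_nonneg x]
  have key : 0 ≤ Real.log (1 + x) - x + x ^ 2 := by
    rcases le_total x (-(1 / 2)) with h1 | h1
    · have hmono : MonotoneOn (fun y : ℝ => Real.log (1 + y) - y + y ^ 2)
          (Set.Icc (-(2 / 3)) (-(1 / 2))) := by
        refine monotoneOn_of_hasDerivWithinAt_nonneg (convex_Icc _ _)
          (f' := fun y => y * (1 + 2 * y) / (1 + y)) ?_ ?_ ?_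
        · exact fun y hy => (hasDerivAt_log_one_add_sub_add_sq
            (by linarith [hy.1])).continuousAt.continuousWithinAt
        · intro y hy
          rw [interior_Icc] at hy
          exact (hasDerivAt_log_one_add_sub_add_sq (by linarith [hy.1])).hasDerivWithinAt
        · intro y hy
          rw [interior_Icc] at hy
          exact div_nonneg (mul_nonneg_of_nonpos_of_nonpos (by linarith [hy.2])
            (by linarith [hy.2])) (by linarith [hy.1])
      have h := hmono ⟨le_rfl, by norm_num⟩ ⟨hx, h1⟩ hx
      refine le_trans ?_ h
      have hlog : Real.log 3 ≤ 10 / 9 := by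
        have h9 : Real.log ((3 : ℝ) ^ 9) ≤ 10 := by
          rw [Real.log_le_iff_le_exp (by norm_num)]
          have he : Real.exp 10 = Real.exp 1 ^ 10 := by
            rw [← Real.exp_nat_mul]
            norm_num
          rw [he]
          calc (3 : ℝ) ^ 9 ≤ 2.7182 ^ 10 := by norm_num
            _ ≤ Real.exp 1 ^ 10 := by
              gcongr
              linarith [Real.exp_one_gt_d9]
        rw [Real.log_pow] at h9
        push_cast at h9
        linarith
      have hthird : Real.log (1 + -(2 / 3)) = -Real.log 3 := by
        rw [← Real.log_inv]
        norm_num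
      simp only [hthird]
      linarith
    · have hanti : AntitoneOn (fun y : ℝ => Real.log (1 + y) - y + y ^ 2)
          (Set.Icc (-(1 / 2)) 0) := by
        refine antitoneOn_of_hasDerivWithinAt_nonpos (convex_Icc _ _)
          (f' := fun y => y * (1 + 2 * y) / (1 + y)) ?_ ?_ ?_
        · exact fun y hy => (hasDerivAt_log_one_add_sub_add_sq
            (by linarith [hy.1])).continuousAt.continuousWithinAt
        · intro y hy
          rw [interior_Icc] at hy
          exact (hasDerivAt_log_one_add_sub_add_sq (by linarith [hy.1])).hasDerivWithinAt
        · intro y hy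
          rw [interior_Icc] at hy
          exact div_nonpos_of_nonpos_of_nonneg (mul_nonpos_of_nonpos_of_nonneg
            hy.2.le (by linarith [hy.1])) (by linarith [hy.1])
      have h := hanti ⟨h1, h0⟩ ⟨by norm_num, le_rfl⟩ h0
      simpa using h
  linarith

lemma exp_sub_sq_le_one_add {x : ℝ} (hx : -(2 / 3) ≤ x) : Real.exp (x - x ^ 2) ≤ 1 + x :=
  (Real.le_log_iff_exp_le (by linarith)).1 (sub_sq_le_log_one_add hx)

lemma exp_mul_one_sub_le_one (a : ℝ) : Real.exp a * (1 - a) ≤ 1 := by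
  calc Real.exp a * (1 - a) ≤ Real.exp a * Real.exp (-a) := by
        gcongr
        exact Real.one_sub_le_exp_neg a
    _ = 1 := by rw [← Real.exp_add, add_neg_cancel, Real.exp_zero]

theorem adaprod_potential_nonincreasing
    (K : ℕ) (hK : 1 ≤ K)
    (w η rhat ℓ : Fin K → ℝ)
    (hw : ∀ i, 0 < w i) (hη : ∀ i, 0 < η i)
    (hrhat : ∀ i, -1 < rhat i ∧ rhat i ≤ 1)
    (hℓ : ∀ i, 0 ≤ ℓ i ∧ ℓ i ≤ 1)
    (hηub : ∀ i, η i ≤ 2 / (3 * (1 + rhat i)))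
    (Z : ℝ) (hZ : Z = ∑ j, η j * w j * Real.exp (η j * rhat j))
    (p : Fin K → ℝ) (hp : ∀ i, p i = η i * w i * Real.exp (η i * rhat i) / Z)
    (r : Fin K → ℝ) (hr : ∀ i, r i = (∑ j, p j * ℓ j) - ℓ i) :
    ∑ i, w i * Real.exp (η i * r i - (η i) ^ 2 * (r i - rhat i) ^ 2) ≤ ∑ i, w i := by
  have hpos : ∀ i, 0 < η i * w i * Real.exp (η i * rhat i) := fun i =>
    mul_pos (mul_pos (hη i) (hw i)) (Real.exp_pos _)
  have hZpos : 0 < Z := by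
    rw [hZ]
    exact Finset.sum_pos (fun i _ => hpos i) ⟨⟨0, hK⟩, Finset.mem_univ _⟩
  have hp_nonneg : ∀ i, 0 ≤ p i := fun i => by
    rw [hp]
    exact (div_pos (hpos i) hZpos).le
  have hp_sum : ∑ i, p i = 1 := by
    simp only [hp]
    rw [← Finset.sum_div, ← hZ, div_self hZpos.ne']
  have hpr : ∑ i, p i * r i = 0 := by
    simp only [hr, mul_sub, Finset.sum_sub_distrib]
    rw [← Finset.sum_mul, hp_sum, one_mul, sub_self]
  have hr_ge : ∀ i, -1 ≤ r i := fun i => by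
    have : 0 ≤ ∑ j, p j * ℓ j := Finset.sum_nonneg fun j _ => mul_nonneg (hp_nonneg j) (hℓ j).1
    linarith [hr i, (hℓ i).2]
  have hterm : ∀ i, w i * Real.exp (η i * r i - (η i) ^ 2 * (r i - rhat i) ^ 2)
      ≤ w i + Z * (p i * r i) := fun i => by
    have hx : -(2 / 3) ≤ η i * (r i - rhat i) := by
      have hb : 0 < 3 * (1 + rhat i) := by linarith [(hrhat i).1]
      have h1 := (le_div_iff₀ hb).1 (hηub i)
      nlinarith [mul_le_mul_of_nonneg_left (hr_ge i) (hη i).le]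
    have hZp : Z * (p i * r i) = η i * w i * Real.exp (η i * rhat i) * r i := by
      rw [hp]
      field_simp
    have hexp : Real.exp (η i * r i - (η i) ^ 2 * (r i - rhat i) ^ 2) = Real.exp (η i * rhat i) *
        Real.exp (η i * (r i - rhat i) - (η i * (r i - rhat i)) ^ 2) := by
      rw [← Real.exp_add]
      ring_nf
    calc w i * Real.exp (η i * r i - (η i) ^ 2 * (r i - rhat i) ^ 2)
        ≤ w i * (Real.exp (η i * rhat i) * (1 + η i * (r i - rhat i))) := by
          rw [hexp]
          have := (hw i).le
          gcongr
          exact exp_sub_sq_le_one_add hx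
      _ = w i * (Real.exp (η i * rhat i) * (1 - η i * rhat i)) + Z * (p i * r i) := by
          rw [hZp]
          ring
      _ ≤ w i * 1 + Z * (p i * r i) := by
          have := (hw i).le
          gcongr
          exact exp_mul_one_sub_le_one _
      _ = w i + Z * (p i * r i) := by rw [mul_one]
  calc ∑ i, w i * Real.exp (η i * r i - (η i) ^ 2 * (r i - rhat i) ^ 2)
      ≤ ∑ i, (w i + Z * (p i * r i)) := Finset.sum_le_sum fun i _ => hterm i
    _ = ∑ i, w i := by rw [Finset.sum_add_distrib, ← Finset.mul_sum, hpr, mul_zero, add_zero]
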